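/- Boundedness of the total density of the discrete-in-time iterates for the 1-2 junction scheme: if f^{1,n}, f^{2,n}, f^{3,n} ∈ B and the time step satisfies Δt ≤ 1, then the explicit Euler updates of the 1-2 junction scheme satisfy Σ_{j=1}^n f^{r,n+1}_j ≤ ρ[f^{r,n}] + Δt (1 − ρ[f^{r,n}]) ≤ 1 for r = 1,2,3. -/

import Mathlib

open Set

noncomputable def rhoF {n : ℕ} (f : Fin n → ℝ) : ℝ := ∑ j, f j

noncomputable def fluxF {n : ℕ} (v f : Fin n → ℝ) : ℝ := ∑ j, v j * f j

noncomputable def gainF {n : ℕ} (η0 : ℝ) (A : Fin n → Fin n → Fin n → ℝ → ℝ)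
    (j : Fin n) (f : Fin n → ℝ) : ℝ :=
  η0 * rhoF f * ∑ h, ∑ k, A h k j (rhoF f) * f h * f k

noncomputable def lossF {n : ℕ} (η0 : ℝ) (f : Fin n → ℝ) : ℝ := η0 * (rhoF f) ^ 2

def admissibleF {n : ℕ} (f : Fin n → ℝ) : Prop :=
  (∀ j, 0 ≤ f j ∧ f j ≤ 1) ∧ rhoF f ≤ 1

noncomputable def deltaC {n : ℕ} (j : Fin n) : ℝ := if (j : ℕ) = 0 then 0 else 1

def IsSpeedLattice {n : ℕ} (hn : 2 ≤ n) (v : Fin n → ℝ) : Prop :=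
  StrictMono v ∧ v ⟨0, by omega⟩ = 0 ∧ v ⟨n - 1, by omega⟩ = 1

def IsFluxLimiterW (Φ : ℝ → ℝ → ℝ) : Prop :=
  (∀ u ∈ Icc (0:ℝ) 1, ∀ w ∈ Icc (0:ℝ) 1, Φ u w ∈ Icc (0:ℝ) 1) ∧
  (∀ u ∈ Icc (0:ℝ) 1, ∀ w ∈ Icc (0:ℝ) 1, 1 < u + w → Φ u w * u ≤ 1 - w)

def IsTableOfGamesW {n : ℕ} (A : Fin n → Fin n → Fin n → ℝ → ℝ) : Prop :=
  (∀ h k j : Fin n, ∀ u ∈ Icc (0:ℝ) 1, A h k j u ∈ Icc (0:ℝ) 1) ∧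
  (∀ h k : Fin n, ∀ u ∈ Icc (0:ℝ) 1, ∑ j, A h k j u = 1)

noncomputable def euler1 {n : ℕ} (v : Fin n → ℝ) (η0 : ℝ) (A : Fin n → Fin n → Fin n → ℝ → ℝ)
    (Φ : ℝ → ℝ → ℝ) (a Δt : ℝ) (fbar1 f1 f2 f3 : Fin n → ℝ) (j : Fin n) : ℝ :=
  f1 j - Δt * v j * ((a * Φ (a * ∑ k, deltaC k * f1 k) (rhoF f2)
      + (1 - a) * Φ ((1 - a) * ∑ k, deltaC k * f1 k) (rhoF f3)) * f1 j
    - Φ (∑ k, fbar1 k) (rhoF f1) * fbar1 j)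
  + Δt * (gainF η0 A j f1 - f1 j * lossF η0 f1)

noncomputable def euler2 {n : ℕ} (v : Fin n → ℝ) (η0 : ℝ) (A : Fin n → Fin n → Fin n → ℝ → ℝ)
    (Φ : ℝ → ℝ → ℝ) (a Δt : ℝ) (Φbar2 : ℝ) (f1 f2 : Fin n → ℝ) (j : Fin n) : ℝ :=
  f2 j - Δt * v j * (Φbar2 * f2 j
    - a * Φ (a * ∑ k, deltaC k * f1 k) (rhoF f2) * f1 j * deltaC j)
  + Δt * (gainF η0 A j f2 - f2 j * lossF η0 f2)

noncomputable def euler3 {n : ℕ} (v : Fin n → ℝ) (η0 : ℝ) (A : Fin n → Fin n → Fin n → ℝ → ℝ)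
    (Φ : ℝ → ℝ → ℝ) (a Δt : ℝ) (Φbar3 : ℝ) (f1 f3 : Fin n → ℝ) (j : Fin n) : ℝ :=
  f3 j - Δt * v j * (Φbar3 * f3 j
    - (1 - a) * Φ ((1 - a) * ∑ k, deltaC k * f1 k) (rhoF f3) * f1 j * deltaC j)
  + Δt * (gainF η0 A j f3 - f3 j * lossF η0 f3)

theorem IsSpeedLattice.mem_Icc {n : ℕ} {hn : 2 ≤ n} {v : Fin n → ℝ}
    (hv : IsSpeedLattice hn v) (j : Fin n) : v j ∈ Icc (0 : ℝ) 1 := by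
  obtain ⟨hmono, h0, h1⟩ := hv
  refine ⟨h0 ▸ hmono.monotone ?_, h1 ▸ hmono.monotone ?_⟩
  · exact Fin.mk_le_of_le_val (Nat.zero_le _)
  · exact Fin.le_def.mpr (Nat.le_sub_one_of_lt j.isLt)

theorem admissibleF.rhoF_mem_Icc {n : ℕ} {f : Fin n → ℝ} (hf : admissibleF f) :
    rhoF f ∈ Icc (0 : ℝ) 1 :=
  ⟨Finset.sum_nonneg fun j _ => (hf.1 j).1, hf.2⟩

theorem deltaC_mem_Icc {n : ℕ} (j : Fin n) : deltaC j ∈ Icc (0 : ℝ) 1 := by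
  unfold deltaC
  split_ifs <;> simp

/-- The interaction terms conserve the total density. -/
theorem sum_gainF_sub_lossF {n : ℕ} {A : Fin n → Fin n → Fin n → ℝ → ℝ}
    (hA : IsTableOfGamesW A) (η0 : ℝ) {f : Fin n → ℝ} (hf : admissibleF f) :
    ∑ j, (gainF η0 A j f - f j * lossF η0 f) = 0 := by
  have hgain : ∑ j, ∑ h, ∑ k, A h k j (rhoF f) * f h * f k = rhoF f * rhoF f := by
    rw [Finset.sum_comm]
    conv_rhs => rw [rhoF, Finset.sum_mul_sum]
    refine Finset.sum_congr rfl fun h _ => ?_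
    rw [Finset.sum_comm]
    refine Finset.sum_congr rfl fun k _ => ?_
    simp only [mul_assoc]
    rw [← Finset.sum_mul, hA.2 h k _ hf.rhoF_mem_Icc, one_mul]
  have hloss : ∑ j, f j * lossF η0 f = rhoF f * lossF η0 f := by
    rw [← Finset.sum_mul, rhoF]
  rw [Finset.sum_sub_distrib, hloss]
  simp only [gainF]
  rw [← Finset.mul_sum, hgain, lossF]
  ring

/-- The limited flux never exceeds the free room. -/
theorem IsFluxLimiterW.mul_le_one_sub {Φ : ℝ → ℝ → ℝ} (hΦ : IsFluxLimiterW Φ) {u w : ℝ}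
    (hu : u ∈ Icc (0 : ℝ) 1) (hw : w ∈ Icc (0 : ℝ) 1) : Φ u w * u ≤ 1 - w := by
  by_cases h : 1 < u + w
  · exact hΦ.2 u hu w hw h
  · have := mul_le_of_le_one_left hu.1 (hΦ.1 u hu w hw).2
    linarith

theorem sum_speed_mul_le {n : ℕ} {v g : Fin n → ℝ} (hv : ∀ j, v j ≤ 1) (hg : ∀ j, 0 ≤ g j) :
    ∑ j, v j * g j ≤ ∑ j, g j :=
  Finset.sum_le_sum fun j _ => mul_le_of_le_one_left (hg j) (hv j)

/-- A single Euler step on a road with outflow rate `c` and inflow `q` whose total is at most the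
limited flux `Φ u ρ * u`. -/
theorem sum_euler_step_le {n : ℕ} {v : Fin n → ℝ} (hv : ∀ j, v j ∈ Icc (0 : ℝ) 1) {η0 : ℝ}
    {A : Fin n → Fin n → Fin n → ℝ → ℝ} (hA : IsTableOfGamesW A)
    {Φ : ℝ → ℝ → ℝ} (hΦ : IsFluxLimiterW Φ) {f q : Fin n → ℝ} (hf : admissibleF f)
    {c u Δt : ℝ} (hc : 0 ≤ c) (hΔt : 0 ≤ Δt) (hu : u ∈ Icc (0 : ℝ) 1)
    (hq : ∀ j, 0 ≤ q j) (hqsum : ∑ j, q j ≤ Φ u (rhoF f) * u) :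
    ∑ j, (f j - Δt * v j * (c * f j - q j) + Δt * (gainF η0 A j f - f j * lossF η0 f)) ≤
      rhoF f + Δt * (1 - rhoF f) := by
  have hsplit : ∑ j, (f j - Δt * v j * (c * f j - q j)
      + Δt * (gainF η0 A j f - f j * lossF η0 f)) =
      rhoF f - Δt * (c * ∑ j, v j * f j) + Δt * ∑ j, v j * q j := by
    rw [Finset.sum_add_distrib, ← Finset.mul_sum, sum_gainF_sub_lossF hA η0 hf, rhoF]
    simp only [Finset.mul_sum]
    rw [mul_zero, add_zero, ← Finset.sum_sub_distrib, ← Finset.sum_add_distrib]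
    exact Finset.sum_congr rfl fun j _ => by ring
  have hin : ∑ j, v j * q j ≤ 1 - rhoF f :=
    ((sum_speed_mul_le (fun j => (hv j).2) hq).trans hqsum).trans
      (hΦ.mul_le_one_sub hu hf.rhoF_mem_Icc)
  have hout : 0 ≤ Δt * (c * ∑ j, v j * f j) :=
    mul_nonneg hΔt (mul_nonneg hc
      (Finset.sum_nonneg fun j _ => mul_nonneg (hv j).1 (hf.1 j).1))
  rw [hsplit]
  linarith [mul_le_mul_of_nonneg_left hin hΔt]

/-- The density able to cross the junction into a road receiving the fraction `b`. -/
theorem junction_demand_mem_Icc {n : ℕ} {f : Fin n → ℝ} (hf : admissibleF f) {b : ℝ}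
    (hb : b ∈ Icc (0 : ℝ) 1) : b * ∑ k, deltaC k * f k ∈ Icc (0 : ℝ) 1 := by
  have h0 : 0 ≤ ∑ k, deltaC k * f k :=
    Finset.sum_nonneg fun k _ => mul_nonneg (deltaC_mem_Icc k).1 (hf.1 k).1
  have h1 : ∑ k, deltaC k * f k ≤ 1 :=
    (sum_speed_mul_le (fun k => (deltaC_mem_Icc k).2) fun k => (hf.1 k).1).trans hf.2
  exact ⟨mul_nonneg hb.1 h0, mul_le_one₀ hb.2 h0 h1⟩

/-- `euler2` with splitting fraction `b` also describes `euler3`, with `b = 1 - a`. -/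
theorem sum_euler2_le {n : ℕ} {v : Fin n → ℝ} (hv : ∀ j, v j ∈ Icc (0 : ℝ) 1) {η0 : ℝ}
    {A : Fin n → Fin n → Fin n → ℝ → ℝ} (hA : IsTableOfGamesW A)
    {Φ : ℝ → ℝ → ℝ} (hΦ : IsFluxLimiterW Φ) {b : ℝ} (hb : b ∈ Icc (0 : ℝ) 1)
    {f g : Fin n → ℝ} (hf : admissibleF f) (hg : admissibleF g) {c Δt : ℝ} (hc : 0 ≤ c)
    (hΔt : 0 ≤ Δt) :
    ∑ j, euler2 v η0 A Φ b Δt c f g j ≤ rhoF g + Δt * (1 - rhoF g) := by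
  have hu := junction_demand_mem_Icc hf hb
  refine sum_euler_step_le hv hA hΦ hg hc hΔt hu (fun j => ?_) (le_of_eq ?_)
  · exact mul_nonneg (mul_nonneg (mul_nonneg hb.1 (hΦ.1 _ hu _ hg.rhoF_mem_Icc).1) (hf.1 j).1)
      (deltaC_mem_Icc j).1
  · rw [← mul_assoc, Finset.mul_sum (f := fun k => deltaC k * f k)
      (a := Φ (b * ∑ k, deltaC k * f k) (rhoF g) * b)]
    exact Finset.sum_congr rfl fun j _ => by ring

/-- Boundedness of the total density of the discrete-in-time iterates. -/
theorem euler_scheme_density_bound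
    {n : ℕ} (hn : 2 ≤ n) (v : Fin n → ℝ) (hv : IsSpeedLattice hn v)
    (η0 : ℝ) (hη0 : 0 < η0)
    (A : Fin n → Fin n → Fin n → ℝ → ℝ) (hA : IsTableOfGamesW A)
    (Φ : ℝ → ℝ → ℝ) (hΦ : IsFluxLimiterW Φ)
    (a : ℝ) (ha : a ∈ Icc (0:ℝ) 1)
    (f1 f2 f3 fbar1 : Fin n → ℝ)
    (hf1 : admissibleF f1) (hf2 : admissibleF f2) (hf3 : admissibleF f3)
    (hfbar1 : admissibleF fbar1)
    (Φbar2 Φbar3 : ℝ) (hΦbar2 : Φbar2 ∈ Icc (0:ℝ) 1) (hΦbar3 : Φbar3 ∈ Icc (0:ℝ) 1)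
    (Δt : ℝ) (hΔt0 : 0 < Δt)
    (hΔt : Δt ≤ 1) :
    ((∑ j, euler1 v η0 A Φ a Δt fbar1 f1 f2 f3 j ≤ rhoF f1 + Δt * (1 - rhoF f1)) ∧
      rhoF f1 + Δt * (1 - rhoF f1) ≤ 1) ∧
    ((∑ j, euler2 v η0 A Φ a Δt Φbar2 f1 f2 j ≤ rhoF f2 + Δt * (1 - rhoF f2)) ∧
      rhoF f2 + Δt * (1 - rhoF f2) ≤ 1) ∧
    ((∑ j, euler3 v η0 A Φ a Δt Φbar3 f1 f3 j ≤ rhoF f3 + Δt * (1 - rhoF f3)) ∧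
      rhoF f3 + Δt * (1 - rhoF f3) ≤ 1) := by
  have hv' := hv.mem_Icc
  have ha' : 1 - a ∈ Icc (0 : ℝ) 1 := ⟨by linarith [ha.2], by linarith [ha.1]⟩
  have hle : ∀ {f : Fin n → ℝ}, admissibleF f → rhoF f + Δt * (1 - rhoF f) ≤ 1 := fun hf => by
    linarith [mul_le_of_le_one_left (sub_nonneg.mpr hf.2) hΔt]
  refine ⟨⟨?_, hle hf1⟩, ⟨sum_euler2_le hv' hA hΦ ha hf1 hf2 hΦbar2.1 hΔt0.le, hle hf2⟩,
    ⟨sum_euler2_le hv' hA hΦ ha' hf1 hf3 hΦbar3.1 hΔt0.le, hle hf3⟩⟩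
  have h2 := (hΦ.1 _ (junction_demand_mem_Icc hf1 ha) _ hf2.rhoF_mem_Icc).1
  have h3 := (hΦ.1 _ (junction_demand_mem_Icc hf1 ha') _ hf3.rhoF_mem_Icc).1
  have hu := hfbar1.rhoF_mem_Icc
  refine sum_euler_step_le hv' hA hΦ hf1
    (add_nonneg (mul_nonneg ha.1 h2) (mul_nonneg ha'.1 h3)) hΔt0.le hu (fun j => ?_) (le_of_eq ?_)
  · exact mul_nonneg (hΦ.1 _ hu _ hf1.rhoF_mem_Icc).1 (hfbar1.1 j).1
  · rw [← Finset.mul_sum, rhoF, rhoF]
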